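/- arXiv:1301.2883 — 2 statements merged into one kernel-verified Lean document; each statement's English description precedes it below -/
import Mathlib

section
/- Let H ∈ (0,1). For s > 0 and h ≥ 0 define f_s(h) := (2s+h)^{2H} − 2^{2H−1}(s^{2H} + (s+h)^{2H}). Then |f_s(h)| ≤ (1/2)(2^{2H} − 1) s^{2H−2} h². (Note that the incremental variance of sub-fractional Brownian motion satisfies σ²_{S^H}(s,s+h) = h^{2H} + f_s(h).) -/
open Real

/-- Taylor bound: a function vanishing to first order at `0` whose second derivative is bounded by
`C` on `[0, ∞)` is bounded by `C h² / 2`. -/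
theorem abs_le_half_mul_sq_of_abs_second_deriv_le {f f' f'' : ℝ → ℝ} {C : ℝ}
    (hf : ∀ y, 0 ≤ y → HasDerivAt f (f' y) y) (hf' : ∀ y, 0 ≤ y → HasDerivAt f' (f'' y) y)
    (h0 : f 0 = 0) (h0' : f' 0 = 0) (hC : ∀ y, 0 ≤ y → |f'' y| ≤ C) {h : ℝ} (hh : 0 ≤ h) :
    |f h| ≤ C * h ^ 2 / 2 := by
  have first_bound : ∀ y, 0 ≤ y → |f' y| ≤ C * y := fun y hy =>
    image_norm_le_of_norm_deriv_right_le_deriv_boundary (a := 0) (b := y) (f := f') (f' := f'')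
      (B := fun x => C * x) (B' := fun _ => C)
      (fun x hx => (hf' x hx.1).continuousAt.continuousWithinAt)
      (fun x hx => (hf' x hx.1).hasDerivWithinAt) (by simp [h0'])
      (fun x => by simpa using (hasDerivAt_id x).const_mul C)
      (fun x hx => hC x hx.1) ⟨hy, le_rfl⟩
  exact image_norm_le_of_norm_deriv_right_le_deriv_boundary (a := 0) (b := h) (f := f) (f' := f')
      (B := fun x => C * x ^ 2 / 2) (B' := fun x => C * x)
      (fun x hx => (hf x hx.1).continuousAt.continuousWithinAt)
      (fun x hx => (hf x hx.1).hasDerivWithinAt) (by simp [h0])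
      (fun x => by
        refine (((hasDerivAt_pow 2 x).const_mul C).div_const 2).congr_deriv ?_
        push_cast
        ring)
      (fun x hx => first_bound x hx.1) ⟨hh, le_rfl⟩

theorem mul_abs_sub_one_mul_two_rpow_le {p : ℝ} (hp0 : 0 ≤ p) (hp2 : p ≤ 2) :
    p * |p - 1| * (2:ℝ) ^ (p - 2) ≤ 2 ^ p - 1 := by
  have hsplit : (2:ℝ) ^ (p - 2) = 2 ^ p / 4 := by
    rw [rpow_sub two_pos]
    norm_num
  have hpos : (0:ℝ) < 2 ^ p := by positivity
  rw [hsplit]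
  rcases le_total p 1 with hp1 | hp1
  · have hinv : (2:ℝ) ^ p * (1 / 2) ^ p = 1 := by
      rw [← mul_rpow (by norm_num) (by norm_num)]
      norm_num
    have hbern : (1 / 2 : ℝ) ^ p ≤ 1 - p / 2 := by
      have := rpow_one_add_le_one_add_mul_self (s := -(1 / 2)) (by norm_num) hp0 hp1
      norm_num at this ⊢
      linarith
    rw [abs_of_nonpos (by linarith)]
    nlinarith [mul_le_mul_of_nonneg_left hbern hpos.le, mul_nonneg hpos.le hp0,
      mul_nonneg hpos.le (mul_nonneg hp0 hp0)]
  · have htwo : (2:ℝ) ≤ 2 ^ p := by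
      simpa using rpow_le_rpow_of_exponent_le (x := (2:ℝ)) (by norm_num) hp1
    rw [abs_of_nonneg (by linarith)]
    have hq : p * (p - 1) ≤ 2 := by nlinarith
    nlinarith [mul_le_mul_of_nonneg_right hq hpos.le]

theorem abs_two_mul_add_rpow_sub_le {q s y : ℝ} (hq : q ≤ 0) (hs : 0 < s) (hy : 0 ≤ y) :
    |(2 * s + y) ^ q - 2 ^ (q + 1) * (s + y) ^ q| ≤ 2 ^ q * s ^ q := by
  have hdouble : (2:ℝ) ^ (q + 1) = 2 * 2 ^ q := by
    rw [rpow_add two_pos, rpow_one, mul_comm]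
  have hlower : (2:ℝ) ^ q * (s + y) ^ q ≤ (2 * s + y) ^ q := by
    rw [← mul_rpow (by norm_num) (by positivity)]
    exact rpow_le_rpow_of_nonpos (by positivity) (by linarith) hq
  have hupper : (2 * s + y) ^ q ≤ 2 ^ q * s ^ q := by
    rw [← mul_rpow (by norm_num) hs.le]
    exact rpow_le_rpow_of_nonpos (by positivity) (by linarith) hq
  have hpos : 0 < (2:ℝ) ^ q * (s + y) ^ q := by positivity
  rw [hdouble, abs_le]
  constructor <;> nlinarith

/-- For the sub-fractional Brownian motion with index `H ∈ (0,1)`,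
writing `f_s(h) = (2s+h)^{2H} − 2^{2H−1}(s^{2H} + (s+h)^{2H})` (so that
`σ²_{S^H}(s,s+h) = h^{2H} + f_s(h)`), one has
`|f_s(h)| ≤ (1/2)(2^{2H} − 1) s^{2H−2} h²` for all `s > 0`, `h ≥ 0`. -/
theorem subfBm_remainder_bound (H : ℝ) (hH : H ∈ Set.Ioo (0:ℝ) 1)
    (s h : ℝ) (hs : 0 < s) (hh : 0 ≤ h) :
    |(2*s + h) ^ (2*H) - 2 ^ (2*H - 1) * (s ^ (2*H) + (s + h) ^ (2*H))|
      ≤ (1/2) * (2 ^ (2*H) - 1) * s ^ (2*H - 2) * h ^ 2 := by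
  obtain ⟨hH0, hH1⟩ := hH
  obtain ⟨p, hp⟩ : ∃ p, p = 2 * H := ⟨_, rfl⟩
  rw [← hp]
  have hp0 : 0 ≤ p := by linarith
  have hp2 : p ≤ 2 := by linarith
  have hasDeriv_rpow : ∀ a q y : ℝ, 0 < a → 0 ≤ y →
      HasDerivAt (fun x => (a + x) ^ q) (q * (a + y) ^ (q - 1)) y := fun a q y ha hy => by
    simpa using ((hasDerivAt_id y).const_add a).rpow_const (p := q)
      (Or.inl (by simp only [id]; positivity))
  have hsplit : (2:ℝ) ^ p = 2 * 2 ^ (p - 1) := by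
    rw [rpow_sub_one two_ne_zero]
    ring
  have taylor := abs_le_half_mul_sq_of_abs_second_deriv_le
    (f := fun x => (2*s + x) ^ p - 2 ^ (p - 1) * (s ^ p + (s + x) ^ p))
    (f' := fun x => p * (2*s + x) ^ (p - 1) - 2 ^ (p - 1) * (p * (s + x) ^ (p - 1)))
    (f'' := fun x => p * ((p - 1) * (2*s + x) ^ (p - 1 - 1))
      - 2 ^ (p - 1) * (p * ((p - 1) * (s + x) ^ (p - 1 - 1))))
    (C := (2 ^ p - 1) * s ^ (p - 2))
    (fun y hy => (hasDeriv_rpow (2*s) p y (by positivity) hy).sub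
      (((hasDeriv_rpow s p y hs hy).const_add _).const_mul _))
    (fun y hy => ((hasDeriv_rpow (2*s) (p-1) y (by positivity) hy).const_mul p).sub
      (((hasDeriv_rpow s (p-1) y hs hy).const_mul p).const_mul _))
    (by
      simp only [add_zero]
      rw [mul_rpow two_pos.le hs.le, hsplit]
      ring)
    (by
      simp only [add_zero]
      rw [mul_rpow two_pos.le hs.le]
      ring)
    (fun y hy => by
      have hbracket := abs_two_mul_add_rpow_sub_le (q := p - 2) (by linarith) hs hy
      have hfactor : p * ((p - 1) * (2*s + y) ^ (p - 1 - 1))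
          - 2 ^ (p - 1) * (p * ((p - 1) * (s + y) ^ (p - 1 - 1)))
          = p * (p - 1) * ((2*s + y) ^ (p - 2) - 2 ^ (p - 2 + 1) * (s + y) ^ (p - 2)) := by
        rw [show p - 1 - 1 = p - 2 by ring, show p - 2 + 1 = p - 1 by ring]
        ring
      rw [hfactor, abs_mul, abs_mul, abs_of_nonneg hp0]
      calc p * |p - 1| * |(2*s + y) ^ (p - 2) - 2 ^ (p - 2 + 1) * (s + y) ^ (p - 2)|
          ≤ p * |p - 1| * (2 ^ (p - 2) * s ^ (p - 2)) := by gcongr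
        _ = p * |p - 1| * 2 ^ (p - 2) * s ^ (p - 2) := by ring
        _ ≤ (2 ^ p - 1) * s ^ (p - 2) := by
          gcongr
          exact mul_abs_sub_one_mul_two_rpow_le hp0 hp2)
    hh
  refine taylor.trans_eq ?_
  ring
end

section
/- Let H ∈ (0,1), K ∈ (0,1], T > 0, and let σ²_{B^{H,K}}(s,t) = 2^{1−K}[|t−s|^{2HK} − (t^{2H}+s^{2H})^K] + t^{2HK} + s^{2HK} be the incremental variance of bifractional Brownian motion. For every φ ∈ Ψ and every δ > 0 with 0 < φ(δ) ≤ T − δ, one has sup_{φ(δ)≤s≤T−δ} sup_{0<h≤δ} |σ²_{B^{H,K}}(s,s+h)/(2^{1−K} h^{2HK}) − 1| ≤ 8 (δ/φ(δ))^{2−2HK} = 8/(L(δ))^{2−2HK}, where L(δ) = φ(δ)/δ. In particular the bifractional Brownian motion satisfies condition (C2) with κ = 2^{(1−K)/2} and exponent γ = HK. -/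
open Real Set Filter

/-- The class Ψ of continuous functions `φ : (0,T] → [0,∞)` with `φ(h) → 0`,
`L(h) = φ(h)/h → ∞` and `h·L(h)³ → 0` as `h ↓ 0`. -/
def MemPsi (T : ℝ) (φ : ℝ → ℝ) : Prop :=
  ContinuousOn φ (Ioc 0 T) ∧ (∀ h ∈ Ioc (0:ℝ) T, 0 ≤ φ h) ∧
  Tendsto φ (nhdsWithin 0 (Ioi 0)) (nhds 0) ∧
  Tendsto (fun h => φ h / h) (nhdsWithin 0 (Ioi 0)) atTop ∧
  Tendsto (fun h => h * (φ h / h) ^ 3) (nhdsWithin 0 (Ioi 0)) (nhds 0)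

/-- Incremental variance of the bifractional Brownian motion with parameters `H`, `K`. -/
noncomputable def sigma2bifBm (H K s t : ℝ) : ℝ :=
  2 ^ (1 - K) * (|t - s| ^ (2*H*K) - (t ^ (2*H) + s ^ (2*H)) ^ K) + t ^ (2*H*K) + s ^ (2*H*K)

/-- Two-point Jensen gap of `t ↦ t ^ K` at the points `1` and `p ^ 2`. -/
lemma abs_jensen_gap_rpow_le {K p : ℝ} (hK0 : 0 < K) (hK1 : K ≤ 1) (hp : 1 ≤ p) :
    |(p ^ 2) ^ K + 1 - 2 ^ (1 - K) * (p ^ 2 + 1) ^ K| ≤ (p - 1) ^ 2 := by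
  have hp0 : 0 < p := by linarith
  have hmean : (2:ℝ) ^ (1 - K) * (p ^ 2 + 1) ^ K = 2 * ((p ^ 2 + 1) / 2) ^ K := by
    rw [Real.div_rpow (by positivity) (by norm_num), Real.rpow_sub (by norm_num), Real.rpow_one]
    ring
  rw [hmean]
  have hconc := (Real.concaveOn_rpow hK0.le hK1).2
    (show p ^ 2 ∈ Set.Ici (0:ℝ) from Set.mem_Ici.2 (by positivity))
    (show (1:ℝ) ∈ Set.Ici (0:ℝ) from Set.mem_Ici.2 zero_le_one)
    (show (0:ℝ) ≤ 1 / 2 by norm_num) (show (0:ℝ) ≤ 1 / 2 by norm_num) (by norm_num)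
  simp only [smul_eq_mul, Real.one_rpow] at hconc
  rw [show 1 / 2 * p ^ 2 + 1 / 2 * 1 = (p ^ 2 + 1) / 2 by ring] at hconc
  have hgeo : 2 * p ^ K ≤ (p ^ 2) ^ K + 1 := by
    rw [← Real.rpow_pow_comm hp0.le]
    nlinarith [sq_nonneg (p ^ K - 1)]
  have hfactor : (p ^ 2 + 1) / 2 = p * (1 + (p - 1) ^ 2 / (2 * p)) := by
    field_simp
    ring
  have hquot : 0 ≤ (p - 1) ^ 2 / (2 * p) := by positivity
  have hbern : (1 + (p - 1) ^ 2 / (2 * p)) ^ K ≤ 1 + K * ((p - 1) ^ 2 / (2 * p)) :=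
    rpow_one_add_le_one_add_mul_self (by linarith) hK0.le hK1
  have hpK : p ^ K ≤ p := by
    simpa using Real.rpow_le_rpow_of_exponent_le hp hK1
  have hupper : ((p ^ 2 + 1) / 2) ^ K ≤ p ^ K + (p - 1) ^ 2 / 2 := by
    calc ((p ^ 2 + 1) / 2) ^ K = p ^ K * (1 + (p - 1) ^ 2 / (2 * p)) ^ K := by
          rw [hfactor, Real.mul_rpow hp0.le (by positivity)]
      _ ≤ p ^ K * (1 + K * ((p - 1) ^ 2 / (2 * p))) := by gcongr
      _ ≤ p ^ K * (1 + 1 * ((p - 1) ^ 2 / (2 * p))) := by gcongr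
      _ = p ^ K + p ^ K * ((p - 1) ^ 2 / (2 * p)) := by ring
      _ ≤ p ^ K + p * ((p - 1) ^ 2 / (2 * p)) := by gcongr
      _ = p ^ K + (p - 1) ^ 2 / 2 := by
          field_simp
  rw [abs_le]
  constructor <;> nlinarith [sq_nonneg (p - 1)]

lemma sigma2bifBm_add_right {H K s h : ℝ} (hs : 0 < s) (hh : 0 < h) :
    sigma2bifBm H K s (s + h) = 2 ^ (1 - K) * h ^ (2*H*K) +
      s ^ (2*H*K) * ((((1 + h / s) ^ H) ^ 2) ^ K + 1
        - 2 ^ (1 - K) * (((1 + h / s) ^ H) ^ 2 + 1) ^ K) := by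
  have hx : 0 < 1 + h / s := by positivity
  have hsum : s + h = s * (1 + h / s) := by field_simp
  have hsq : ((1 + h / s) ^ H) ^ 2 = (1 + h / s) ^ (2*H) := by
    rw [← Real.rpow_natCast, ← Real.rpow_mul hx.le]
    norm_num [mul_comm]
  rw [hsq, ← Real.rpow_mul hx.le]
  unfold sigma2bifBm
  rw [add_sub_cancel_left, abs_of_pos hh, hsum, Real.mul_rpow hs.le hx.le,
    Real.mul_rpow hs.le hx.le,
    show s ^ (2*H) * (1 + h / s) ^ (2*H) + s ^ (2*H) = s ^ (2*H) * ((1 + h / s) ^ (2*H) + 1) by ring,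
    Real.mul_rpow (by positivity) (by positivity), ← Real.rpow_mul hs.le]
  ring

lemma abs_sigma2bifBm_div_sub_one_le {H K s h : ℝ} (hH : H ∈ Set.Ioo (0:ℝ) 1)
    (hK : K ∈ Set.Ioc (0:ℝ) 1) (hs : 0 < s) (hh : 0 < h) :
    |sigma2bifBm H K s (s + h) / (2 ^ (1 - K) * h ^ (2*H*K)) - 1|
      ≤ (h / s) ^ (2 - 2*H*K) := by
  have hx : 0 < h / s := by positivity
  have hp : 1 ≤ (1 + h / s) ^ H := Real.one_le_rpow (by linarith) hH.1.le
  have hbern : (1 + h / s) ^ H ≤ 1 + H * (h / s) :=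
    rpow_one_add_le_one_add_mul_self (by linarith) hH.1.le hH.2.le
  have hgap := abs_jensen_gap_rpow_le hK.1 hK.2 hp
  rw [sigma2bifBm_add_right hs hh]
  set D := (((1 + h / s) ^ H) ^ 2) ^ K + 1 - 2 ^ (1 - K) * (((1 + h / s) ^ H) ^ 2 + 1) ^ K
  have hD : |D| ≤ (h / s) ^ 2 :=
    hgap.trans (pow_le_pow_left₀ (by linarith) (by nlinarith [hH.2]) 2)
  have hc : (1:ℝ) ≤ 2 ^ (1 - K) := Real.one_le_rpow (by norm_num) (by linarith [hK.2])
  have hpow : 0 < h ^ (2*H*K) := by positivity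
  have hspow : 0 < s ^ (2*H*K) := by positivity
  have hdiv : (2 ^ (1 - K) * h ^ (2*H*K) + s ^ (2*H*K) * D) / (2 ^ (1 - K) * h ^ (2*H*K)) - 1
      = s ^ (2*H*K) * D / (2 ^ (1 - K) * h ^ (2*H*K)) := by
    field_simp
    ring
  have hden : 0 < 2 ^ (1 - K) * h ^ (2*H*K) := by positivity
  rw [hdiv, abs_div, abs_mul, abs_of_pos hspow, abs_of_pos hden]
  calc s ^ (2*H*K) * |D| / (2 ^ (1 - K) * h ^ (2*H*K))
      ≤ s ^ (2*H*K) * (h / s) ^ 2 / (1 * h ^ (2*H*K)) := by gcongr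
    _ = (h / s) ^ (2 - 2*H*K) := by
        rw [Real.rpow_sub hx, Real.rpow_two, Real.div_rpow hh.le hs.le]
        field_simp

/-- Quantitative form of condition (C2) (with `κ = 2^{(1−K)/2}`,
`γ = HK`) for the bifractional Brownian motion. -/
theorem bifBm_C2_bound (H K T : ℝ) (hH : H ∈ Set.Ioo (0:ℝ) 1) (hK : K ∈ Set.Ioc (0:ℝ) 1)
    (hT : 0 < T) (φ : ℝ → ℝ) (hφ : MemPsi T φ) (δ : ℝ) (hδ : 0 < δ)
    (hφδ : 0 < φ δ) (hφδT : φ δ ≤ T - δ) :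
    (⨆ s ∈ Icc (φ δ) (T - δ), ⨆ h ∈ Ioc (0:ℝ) δ,
        |sigma2bifBm H K s (s + h) / (2 ^ (1 - K) * h ^ (2*H*K)) - 1|)
      ≤ 8 * (δ / φ δ) ^ (2 - 2*H*K) := by
  have hexp : 0 ≤ 2 - 2*H*K := by
    nlinarith [hH.1, hH.2, hK.1, hK.2, mul_le_mul hH.2.le hK.2 hK.1.le zero_le_one]
  have hbound : 0 ≤ 8 * (δ / φ δ) ^ (2 - 2*H*K) := by positivity
  refine Real.iSup_le (fun s => Real.iSup_le (fun hs => Real.iSup_le (fun h =>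
    Real.iSup_le (fun hh => ?_) hbound) hbound) hbound) hbound
  have hs0 : 0 < s := hφδ.trans_le hs.1
  have hh0 : 0 < h := hh.1
  have hmono : (h / s) ^ (2 - 2*H*K) ≤ (δ / φ δ) ^ (2 - 2*H*K) :=
    Real.rpow_le_rpow (by positivity) (div_le_div₀ hδ.le hh.2 hφδ hs.1) hexp
  have hnonneg : 0 ≤ (δ / φ δ) ^ (2 - 2*H*K) := by positivity
  linarith [abs_sigma2bifBm_div_sub_one_le hH hK hs0 hh0]
end
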